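/- For all integers p ≥ q ≥ 2 with p < q(q+1)/2, every finite indexed family of axis-parallel rectangles in the plane satisfying the (p,q)-property can be pierced by at most p − q + 1 points. -/

import Mathlib

/-- The `(p,q)`-property for a finite indexed family of sets. -/
def HasPQ {ι α : Type*} [Fintype ι] (F : ι → Set α) (p q : ℕ) : Prop :=
  p ≤ Fintype.card ι ∧
    ∀ J : Finset ι, J.card = p → ∃ K ⊆ J, K.card = q ∧ (⋂ k ∈ K, F k).Nonempty

/-- `P` pierces the family `F`: every member of `F` contains a point of `P`. -/
def Pierces {ι α : Type*} (F : ι → Set α) (P : Finset α) : Prop :=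
  ∀ i, ∃ x ∈ P, x ∈ F i

/-- An axis-parallel rectangle in the plane: a nonempty product of two closed
bounded intervals, i.e. `Set.Icc a b` in `ℝ × ℝ` with `a ≤ b`. -/
def IsRect (A : Set (ℝ × ℝ)) : Prop :=
  ∃ a b : ℝ × ℝ, a ≤ b ∧ A = Set.Icc a b

/-- A family of axis-parallel rectangles, given by their lower left and upper right corners. -/
structure RectFamily (ι : Type*) where
  lo : ι → ℝ × ℝ
  hi : ι → ℝ × ℝ
  lo_le_hi : ∀ i, lo i ≤ hi i

namespace RectFamily

variable {ι : Type*} (R : RectFamily ι)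

/-- The rectangles indexed by `K` intersect pairwise. -/
def IsClique (K : Finset ι) : Prop :=
  ∀ i ∈ K, ∀ j ∈ K, R.lo i ≤ R.hi j

/-- Some `q` rectangles of the subfamily `F` intersect pairwise. -/
def HasClique (q : ℕ) (F : Finset ι) : Prop :=
  ∃ K ⊆ F, K.card = q ∧ R.IsClique K

/-- The subfamily `F` can be pierced by at most `n` points. -/
def Pierced (F : Finset ι) (n : ℕ) : Prop :=
  ∃ P : Finset (ℝ × ℝ), P.card ≤ n ∧ ∀ i ∈ F, ∃ x ∈ P, R.lo i ≤ x ∧ x ≤ R.hi i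

/-- Subfamilies of `F` without `q` pairwise intersecting members have at most `m` members. -/
def CliqueFreeBound (q m : ℕ) (F : Finset ι) : Prop :=
  ∀ D ⊆ F, ¬ R.HasClique q D → D.card ≤ m

/-- `A` lies to the left of `C`, and the other members of `F` meet the vertical line at
abscissa `x`, which separates `A` from `C`. -/
structure Cut (F A C : Finset ι) (x : ℝ) : Prop where
  left_subset : A ⊆ F
  right_subset : C ⊆ F
  hi_le : ∀ a ∈ A, (R.hi a).1 ≤ x
  le_lo : ∀ c ∈ C, x ≤ (R.lo c).1
  sep : ∀ a ∈ A, ∀ c ∈ C, (R.hi a).1 < (R.lo c).1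
  mid : ∀ f ∈ F, f ∉ A → f ∉ C → (R.lo f).1 ≤ x ∧ x ≤ (R.hi f).1

variable {R} {F A B C D K S T Y : Finset ι} {a b m n q : ℕ} {x : ℝ} {i j : ι}

theorem IsClique.mono (h : R.IsClique K) (hS : S ⊆ K) : R.IsClique S :=
  fun i hi j hj => h i (hS hi) j (hS hj)

theorem HasClique.mono (h : R.HasClique q F) (hF : F ⊆ D) : R.HasClique q D := by
  obtain ⟨K, hK, hc, hcl⟩ := h
  exact ⟨K, hK.trans hF, hc, hcl⟩

theorem HasClique.of_le (h : R.HasClique q F) (ha : a ≤ q) : R.HasClique a F := by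
  obtain ⟨K, hK, hc, hcl⟩ := h
  obtain ⟨L, hL, hLc⟩ := Finset.exists_subset_card_eq (hc ▸ ha : a ≤ K.card)
  exact ⟨L, hL.trans hK, hLc, hcl.mono hL⟩

theorem HasClique.le_card (h : R.HasClique q F) : q ≤ F.card := by
  obtain ⟨K, hK, hc, -⟩ := h
  exact hc ▸ Finset.card_le_card hK

theorem not_hasClique_of_card_lt (h : F.card < q) : ¬ R.HasClique q F :=
  fun hF => absurd hF.le_card (by omega)

theorem exists_hasClique_not_succ (F : Finset ι) :
    ∃ a, R.HasClique a F ∧ ¬ R.HasClique (a + 1) F := by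
  by_contra! h
  have : ∀ a, R.HasClique a F := fun a => by
    induction a with
    | zero => exact ⟨∅, by simp, rfl, by simp [IsClique]⟩
    | succ a ih => exact h a ih
  exact not_hasClique_of_card_lt (Nat.lt_succ_self _) (this (F.card + 1))

theorem exists_max_cliqueFree (hq : q ≠ 0) (F : Finset ι) :
    ∃ D ⊆ F, ¬ R.HasClique q D ∧ R.CliqueFreeBound q D.card F := by
  classical
  obtain ⟨D, hD, hmax⟩ := Finset.exists_max_image
    (F.powerset.filter fun D => ¬ R.HasClique q D) Finset.card
    ⟨∅, by simpa using not_hasClique_of_card_lt (by simpa using Nat.pos_of_ne_zero hq)⟩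
  simp only [Finset.mem_filter, Finset.mem_powerset] at hD hmax
  exact ⟨D, hD.1, hD.2, fun E hE hE' => hmax E ⟨hE, hE'⟩⟩

theorem Pierced.mono (h : R.Pierced F m) (hmn : m ≤ n) : R.Pierced F n := by
  obtain ⟨P, hP, h⟩ := h
  exact ⟨P, hP.trans hmn, h⟩

theorem Pierced.subset (h : R.Pierced F n) (hD : D ⊆ F) : R.Pierced D n := by
  obtain ⟨P, hP, h⟩ := h
  exact ⟨P, hP, fun i hi => h i (hD hi)⟩

/-- Pairwise intersecting rectangles have a common point. -/
theorem IsClique.exists_point (h : R.IsClique K) :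
    ∃ x : ℝ × ℝ, ∀ i ∈ K, R.lo i ≤ x ∧ x ≤ R.hi i := by
  rcases K.eq_empty_or_nonempty with rfl | hK
  · exact ⟨0, by simp⟩
  · exact ⟨K.sup' hK R.lo, fun i hi =>
      ⟨Finset.le_sup' R.lo hi, Finset.sup'_le hK R.lo fun j hj => h j hj i hi⟩⟩

theorem IsClique.pierced (h : R.IsClique K) : R.Pierced K 1 := by
  obtain ⟨x, hx⟩ := h.exists_point
  exact ⟨{x}, by simp, fun i hi => ⟨x, by simp, hx i hi⟩⟩

theorem pierced_of_cover {κ : Type*} (T : Finset κ) (G : κ → Finset ι)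
    (hG : ∀ t ∈ T, R.IsClique (G t)) (hF : ∀ i ∈ F, ∃ t ∈ T, i ∈ G t) :
    R.Pierced F T.card := by
  classical
  have : ∀ t, ∃ x : ℝ × ℝ, t ∈ T → ∀ i ∈ G t, R.lo i ≤ x ∧ x ≤ R.hi i := fun t => by
    by_cases ht : t ∈ T
    · obtain ⟨x, hx⟩ := (hG t ht).exists_point
      exact ⟨x, fun _ => hx⟩
    · exact ⟨0, fun h => absurd h ht⟩
  choose p hp using this
  refine ⟨T.image p, Finset.card_image_le, fun i hi => ?_⟩
  obtain ⟨t, ht, hit⟩ := hF i hi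
  exact ⟨p t, Finset.mem_image_of_mem p ht, hp t ht i hit⟩

theorem disjoint_of_sep (hsep : ∀ a ∈ A, ∀ c ∈ C, (R.hi a).1 < (R.lo c).1) : Disjoint A C :=
  Finset.disjoint_left.2 fun i hA hC =>
    absurd (hsep i hA i hC) (not_lt.2 (R.lo_le_hi i).1)

variable [DecidableEq ι]

theorem card_inter_le_of_not_hasClique (hA : ¬ R.HasClique (a + 1) A) (hK : R.IsClique K) :
    (K ∩ A).card ≤ a := by
  by_contra! h
  exact hA (HasClique.of_le ⟨K ∩ A, Finset.inter_subset_right, rfl,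
    hK.mono Finset.inter_subset_left⟩ h)

theorem not_hasClique_union (hA : ¬ R.HasClique (a + 1) A) (hB : ¬ R.HasClique (b + 1) B) :
    ¬ R.HasClique (a + b + 1) (A ∪ B) := by
  rintro ⟨K, hK, hc, hcl⟩
  have h1 := card_inter_le_of_not_hasClique hA hcl
  have h2 := card_inter_le_of_not_hasClique hB hcl
  have h3 : (K ∩ A ∪ K ∩ B).card = K.card := by
    rw [← Finset.inter_union_distrib_left, Finset.inter_eq_left.2 hK]
  have h4 := Finset.card_union_le (K ∩ A) (K ∩ B)
  omega

theorem Pierced.union (hA : R.Pierced A m) (hB : R.Pierced B n) :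
    R.Pierced (A ∪ B) (m + n) := by
  obtain ⟨P, hP, hA⟩ := hA
  obtain ⟨Q, hQ, hB⟩ := hB
  refine ⟨P ∪ Q, (Finset.card_union_le P Q).trans (by omega), fun i hi => ?_⟩
  rcases Finset.mem_union.1 hi with hi | hi
  · obtain ⟨x, hx, h⟩ := hA i hi
    exact ⟨x, Finset.mem_union_left _ hx, h⟩
  · obtain ⟨x, hx, h⟩ := hB i hi
    exact ⟨x, Finset.mem_union_right _ hx, h⟩

theorem pierced_card (F : Finset ι) : R.Pierced F F.card :=
  pierced_of_cover F (fun i => {i})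
    (fun t _ i hi j hj => by
      rw [Finset.mem_singleton.1 hi, Finset.mem_singleton.1 hj]; exact R.lo_le_hi t)
    (fun i hi => ⟨i, hi, by simp⟩)

theorem HasClique.pierced (h : R.HasClique q A) (hn : A.card + 1 ≤ n + q) :
    R.Pierced A n := by
  obtain ⟨K, hK, hc, hcl⟩ := h
  have h1 := (pierced_card (R := R) (A \ K)).union hcl.pierced
  rw [Finset.sdiff_union_of_subset hK] at h1
  have := Finset.card_sdiff_add_card_eq_card hK
  exact h1.mono (by omega)

/-- For rectangles meeting a vertical line, the piercing number is at most the maximal number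
of pairwise disjoint members. -/
theorem exists_disjoint_pierced (x : ℝ) (B : Finset ι)
    (hB : ∀ i ∈ B, (R.lo i).1 ≤ x ∧ x ≤ (R.hi i).1) :
    ∃ S ⊆ B, ¬ R.HasClique 2 S ∧ R.Pierced B S.card := by
  classical
  induction B using Finset.strongInduction with
  | H B ih =>
    rcases B.eq_empty_or_nonempty with rfl | hne
    · exact ⟨∅, le_rfl, not_hasClique_of_card_lt (by simp), pierced_card _⟩
    obtain ⟨g, hg, hmin⟩ := Finset.exists_min_image B (fun i => (R.hi i).2) hne
    have hgt : ∀ i, i ∈ B.filter (fun i => (R.hi g).2 < (R.lo i).2) ↔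
        i ∈ B ∧ (R.hi g).2 < (R.lo i).2 := fun i => Finset.mem_filter
    set U := B.filter fun i => (R.hi g).2 < (R.lo i).2 with hU
    have hgU : g ∉ U := fun h => absurd ((hgt g).1 h).2 (not_lt.2 (R.lo_le_hi g).2)
    have hUB : U ⊆ B := Finset.filter_subset _ _
    obtain ⟨S, hSU, hS, hP⟩ := ih U (Finset.ssubset_iff_subset_ne.2 ⟨hUB, fun h => hgU (h ▸ hg)⟩)
      fun i hi => hB i (hUB hi)
    have hgS : g ∉ S := fun h => hgU (hSU h)
    refine ⟨insert g S, Finset.insert_subset hg (hSU.trans hUB), ?_, ?_⟩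
    · rintro ⟨K, hK, hc, hcl⟩
      by_cases hgK : g ∈ K
      · obtain ⟨i, hi, hig⟩ := Finset.exists_mem_ne (by omega : 1 < K.card) g
        have hiS : i ∈ S := (Finset.mem_insert.1 (hK hi)).resolve_left hig
        exact absurd ((hgt i).1 (hSU hiS)).2 (not_lt.2 (hcl i hi g hgK).2)
      · exact hS ⟨K, (Finset.subset_insert_iff_of_notMem hgK).1 hK, hc, hcl⟩
    · have hcl : R.IsClique (B \ U) := fun i hi j hj => by
        rw [Finset.mem_sdiff, hgt, not_and, not_lt] at hi hj
        exact ⟨(hB i hi.1).1.trans (hB j hj.1).2, (hi.2 hi.1).trans (hmin j hj.1)⟩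
      have := hcl.pierced.union hP
      rw [Finset.sdiff_union_of_subset hUB] at this
      rw [Finset.card_insert_of_notMem hgS]
      exact this.mono (by omega)

theorem not_hasClique_union_of_sep (hsep : ∀ a ∈ A, ∀ c ∈ C, (R.hi a).1 < (R.lo c).1)
    (hA : ¬ R.HasClique q A) (hC : ¬ R.HasClique q C) : ¬ R.HasClique q (A ∪ C) := by
  rintro ⟨K, hK, hc, hcl⟩
  by_cases h : ∃ a ∈ K, a ∈ A
  · obtain ⟨a, haK, ha⟩ := h
    refine hA ⟨K, fun i hi => (Finset.mem_union.1 (hK hi)).resolve_right fun hiC => ?_, hc, hcl⟩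
    exact absurd (hsep a ha i hiC) (not_lt.2 (hcl i hi a haK).1)
  · push Not at h
    exact hC ⟨K, fun i hi => (Finset.mem_union.1 (hK hi)).resolve_left (h i hi), hc, hcl⟩

theorem Cut.exists_disjoint_pierced (h : R.Cut F A C x) :
    ∃ S ⊆ F \ (A ∪ C), ¬ R.HasClique 2 S ∧ R.Pierced (F \ (A ∪ C)) S.card :=
  RectFamily.exists_disjoint_pierced x _ fun i hi => by
    rw [Finset.mem_sdiff, Finset.mem_union, not_or] at hi
    exact h.mid i hi.1 hi.2.1 hi.2.2

theorem Cut.union_subset (h : R.Cut F A C x) : A ∪ C ⊆ F :=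
  Finset.union_subset h.left_subset h.right_subset

/-- A cut whose sides both contain an intersecting pair but no `q - 1` pairwise intersecting
members. -/
theorem Cut.pierced_of_not_hasClique (h : R.Cut F A C x) (hA : R.HasClique 2 A)
    (hC : R.HasClique 2 C) (hA' : ¬ R.HasClique (q - 1) A) (hC' : ¬ R.HasClique (q - 1) C)
    (hF : R.HasClique q F) (hm : R.CliqueFreeBound q m F) (hn : m + 2 ≤ n + q) :
    R.Pierced F n := by
  obtain ⟨a, ha, ha'⟩ := exists_hasClique_not_succ (R := R) (A ∪ C)
  have h2a : 2 ≤ a := by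
    by_contra! h2
    exact ha' ((hA.mono Finset.subset_union_left).of_le (by omega))
  have haq : a + 2 ≤ q := by
    by_contra! h2
    exact not_hasClique_union_of_sep h.sep hA' hC' (ha.of_le (by omega))
  have hdisj := disjoint_of_sep h.sep
  have hcard := Finset.card_union_of_disjoint hdisj
  have hP : R.Pierced (A ∪ C) ((A ∪ C).card - a) := by
    by_cases haA : R.HasClique a A
    · have h1 := haA.le_card
      have h2 := hC.le_card
      exact ((haA.pierced (n := A.card + 1 - a) (by omega)).union
        (hC.pierced (n := C.card - 1) (by omega))).mono (by omega)
    · by_cases haC : R.HasClique a C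
      · have h1 := haC.le_card
        have h2 := hA.le_card
        exact ((hA.pierced (n := A.card - 1) (by omega)).union
          (haC.pierced (n := C.card + 1 - a) (by omega))).mono (by omega)
      · exact absurd ha (not_hasClique_union_of_sep h.sep haA haC)
  obtain ⟨S, hSB, hS, hPB⟩ := h.exists_disjoint_pierced
  set B := F \ (A ∪ C)
  have hFU : A ∪ C ∪ S ∪ (B \ S) = F := by
    rw [Finset.union_assoc, Finset.union_sdiff_of_subset hSB,
      Finset.union_sdiff_of_subset h.union_subset]
  have hYcard : q - 2 - a ≤ (B \ S).card := by
    by_contra! hlt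
    have := not_hasClique_union (not_hasClique_union ha' hS)
      (not_hasClique_of_card_lt (R := R) (Nat.lt_succ_self (B \ S).card))
    rw [hFU] at this
    exact this (hF.of_le (by omega))
  obtain ⟨Y, hY, hYc⟩ := Finset.exists_subset_card_eq hYcard
  have hfree := not_hasClique_union (not_hasClique_union ha' hS)
    (not_hasClique_of_card_lt (R := R) (Nat.lt_succ_self Y.card))
  have hle := hm (A ∪ C ∪ S ∪ Y)
    ((Finset.union_subset_union_right hY).trans hFU.le) fun hc => hfree (hc.of_le (by omega))
  rw [Finset.card_union_of_disjoint, Finset.card_union_of_disjoint] at hle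
  · have := hP.union hPB
    rw [Finset.union_sdiff_of_subset h.union_subset] at this
    have := ha.le_card
    exact Pierced.mono ‹_› (by omega)
  · exact (Finset.disjoint_sdiff (s := A ∪ C) (t := F)).mono_right hSB
  · rw [Finset.disjoint_union_left]
    exact ⟨(Finset.disjoint_sdiff (s := A ∪ C) (t := F)).mono_right
      (hY.trans Finset.sdiff_subset), Finset.disjoint_sdiff.mono_right hY⟩

/-- A cut none of whose sides contains an intersecting pair. -/
theorem Cut.pierced_of_disjoint (h : R.Cut F A C x) (hq : 4 ≤ q) (hA : ¬ R.HasClique 2 A)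
    (hC : ¬ R.HasClique 2 C) (hF : R.HasClique q F) (hm : R.CliqueFreeBound q m F)
    (hn : m + 2 ≤ n + q) : R.Pierced F n := by
  classical
  obtain ⟨S, hSB, hS, hPB⟩ := h.exists_disjoint_pierced
  have hT := not_hasClique_union_of_sep h.sep hA hC
  have hTF := h.union_subset
  have hline : ∀ i ∈ F \ (A ∪ C), (R.lo i).1 ≤ x ∧ x ≤ (R.hi i).1 := fun i hi => by
    rw [Finset.mem_sdiff, Finset.mem_union, not_or] at hi
    exact h.mid i hi.1 hi.2.1 hi.2.2
  generalize A ∪ C = T at *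
  obtain ⟨B, hB⟩ : ∃ B, B = F \ T := ⟨_, rfl⟩
  rw [← hB] at hSB hPB hline
  obtain ⟨Q, hQ⟩ : ∃ Q, Q = B \ S := ⟨_, rfl⟩
  have hFU : T ∪ S ∪ Q = F := by grind
  have hcard : ∀ Y ⊆ Q, (T ∪ S ∪ Y).card = T.card + S.card + Y.card := fun Y hY => by
    rw [Finset.card_union_of_disjoint, Finset.card_union_of_disjoint]
    · exact Finset.disjoint_left.2 (by grind)
    · exact Finset.disjoint_left.2 (by grind)
  have hfree : ∀ Y : Finset ι, ¬ R.HasClique (Y.card + 3) (T ∪ S ∪ Y) := fun Y hc =>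
    not_hasClique_union (not_hasClique_union hT hS)
      (not_hasClique_of_card_lt (R := R) (Nat.lt_succ_self Y.card)) (hc.of_le (by omega))
  have hQc : q - 2 ≤ Q.card := by
    by_contra! hlt
    have := hfree Q
    rw [hFU] at this
    exact this (hF.of_le (by omega))
  by_cases hcl : ∃ Y ⊆ Q, Y.card = q - 2 ∧ ¬ R.HasClique q (T ∪ S ∪ Y)
  · obtain ⟨Y, hY, hYc, hYfree⟩ := hcl
    have := hm _ (by grind) hYfree
    rw [hcard Y hY] at this
    have hP := (pierced_card (R := R) T).union hPB
    rw [show T ∪ B = F by grind] at hP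
    exact hP.mono (by omega)
  have hst : ∀ Y ⊆ Q, Y.card = q - 2 → ∃ s ∈ S, ∃ t ∈ T, ∃ K, R.IsClique K ∧
      s ∈ K ∧ t ∈ K ∧ Y ⊆ K := fun Y hY hYc => by
    have : R.HasClique q (T ∪ S ∪ Y) := by
      by_contra hno
      exact hcl ⟨Y, hY, hYc, hno⟩
    obtain ⟨K, hK, hKc, hKcl⟩ := this
    have h1 := card_inter_le_of_not_hasClique hT hKcl
    have h2 := card_inter_le_of_not_hasClique hS hKcl
    have h3 : (K ∩ Y).card ≤ Y.card := Finset.card_le_card Finset.inter_subset_right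
    have h4 : (K ∩ T ∪ K ∩ S ∪ K ∩ Y).card = K.card := by
      rw [← Finset.inter_union_distrib_left, ← Finset.inter_union_distrib_left,
        Finset.inter_eq_left.2 hK]
    have h5 := Finset.card_union_le (K ∩ T ∪ K ∩ S) (K ∩ Y)
    have h6 := Finset.card_union_le (K ∩ T) (K ∩ S)
    obtain ⟨t, ht⟩ := Finset.card_pos.1 (by omega : 0 < (K ∩ T).card)
    obtain ⟨s, hs⟩ := Finset.card_pos.1 (by omega : 0 < (K ∩ S).card)
    have h7 := Finset.eq_of_subset_of_card_le
      (Finset.inter_subset_right : K ∩ Y ⊆ Y) (by omega)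
    exact ⟨s, (Finset.mem_inter.1 hs).2, t, (Finset.mem_inter.1 ht).2, K, hKcl,
      (Finset.mem_inter.1 hs).1, (Finset.mem_inter.1 ht).1, Finset.inter_eq_right.1 h7⟩
  have hpair : ∀ g ∈ Q, ∀ g' ∈ Q, ∃ s ∈ S, ∃ t ∈ T, ∃ K, R.IsClique K ∧
      s ∈ K ∧ t ∈ K ∧ g ∈ K ∧ g' ∈ K := fun g hg g' hg' => by
    obtain ⟨Y, hY, hYQ, hYc⟩ := Finset.exists_subsuperset_card_eq
      (by grind : ({g, g'} : Finset ι) ⊆ Q) (by grind [Finset.card_le_two]) hQc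
    obtain ⟨s, hs, t, ht, K, hK, hsK, htK, hYK⟩ := hst Y hYQ hYc
    exact ⟨s, hs, t, ht, K, hK, hsK, htK, hYK (hY (by simp)), hYK (hY (by simp))⟩
  have hQcl : R.IsClique Q := fun g hg g' hg' => by
    obtain ⟨s, hs, t, ht, K, hK, hsK, htK, hgK, hgK'⟩ := hpair g hg g' hg'
    exact hK g hgK g' hgK'
  have hQne : Q.Nonempty := Finset.card_pos.1 (by omega)
  obtain ⟨g, hg, hgmax⟩ := Finset.exists_max_image Q (fun i => (R.lo i).2) hQne
  obtain ⟨g', hg', hgmin⟩ := Finset.exists_min_image Q (fun i => (R.hi i).2) hQne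
  obtain ⟨s, hs, t, ht, K, hK, hsK, htK, hgK, hgK'⟩ := hpair g hg g' hg'
  have hsQ : ∀ i ∈ Q, R.lo s ≤ R.hi i ∧ R.lo i ≤ R.hi s := fun i hi => by
    have hsx := hline s (hSB hs)
    have hix := hline i (by grind)
    exact ⟨⟨hsx.1.trans hix.2, (hK s hsK g' hgK').2.trans (hgmin i hi)⟩,
      ⟨hix.1.trans hsx.2, (hgmax i hi).trans (hK g hgK s hsK).2⟩⟩
  have hTQ : R.Pierced (T ∪ Q ∪ {s}) T.card := by
    refine pierced_of_cover T (fun u => insert u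
      (Q.filter (fun i => R.lo i ≤ R.hi u ∧ R.lo u ≤ R.hi i) ∪ if u = t then {s} else ∅)) ?_ ?_
    · intro u hu i hi j hj
      have hst1 := hK s hsK t htK
      have hst2 := hK t htK s hsK
      have hle := R.lo_le_hi
      have : ∀ v ∈ insert u (Q.filter (fun i => R.lo i ≤ R.hi u ∧ R.lo u ≤ R.hi i) ∪
          if u = t then {s} else ∅), v = u ∨
            (v ∈ Q ∧ R.lo v ≤ R.hi u ∧ R.lo u ≤ R.hi v) ∨ (v = s ∧ u = t) := by
        intro v hv
        split_ifs at hv with hut <;> simp at hv <;> tauto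
      rcases this i hi with rfl | hi | hi <;> rcases this j hj with rfl | hj | hj
      · exact hle _
      · exact hj.2.2
      · rw [hj.1, hj.2]; exact hst2
      · exact hi.2.1
      · exact hQcl _ hi.1 _ hj.1
      · rw [hj.1]; exact (hsQ i hi.1).2
      · rw [hi.1, hi.2]; exact hst1
      · rw [hi.1]; exact (hsQ j hj.1).1
      · rw [hi.1, hj.1]; exact hle s
    · intro i hi
      rcases Finset.mem_union.1 hi with hi | hi
      · rcases Finset.mem_union.1 hi with hi | hi
        · exact ⟨i, hi, by simp⟩
        · obtain ⟨s', -, u, hu, L, hL, -, huL, hiL, -⟩ := hpair i hi i hi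
          exact ⟨u, hu, by simp [hi, hL i hiL u huL, hL u huL i hiL]⟩
      · exact ⟨t, ht, by simp [Finset.mem_singleton.1 hi]⟩
  have hP := hTQ.union (pierced_card (R := R) (S.erase s))
  obtain ⟨Y, hY, hYc⟩ := Finset.exists_subset_card_eq (by omega : q - 3 ≤ Q.card)
  have hle := hm (T ∪ S ∪ Y) (by grind) fun hc => hfree Y (hc.of_le (by omega))
  rw [hcard Y hY] at hle
  have h1 := Finset.card_erase_add_one hs
  exact (hP.subset (by grind)).mono (by omega)

theorem Cut.exists_first (hF : R.HasClique 2 F) :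
    ∃ x A C, ∃ r ∈ A, R.Cut F A C x ∧ R.Cut F (A.erase r) C x ∧
      R.HasClique 2 A ∧ ¬ R.HasClique 2 (A.erase r) := by
  classical
  have hne : F.Nonempty := Finset.card_pos.1 (by have := hF.le_card; omega)
  have h0 : ∃ A ∈ F.powerset.filter fun A => R.HasClique 2 A ∧ ∃ x C, R.Cut F A C x,
      ∀ A' ∈ F.powerset.filter fun A => R.HasClique 2 A ∧ ∃ x C, R.Cut F A C x,
        A.card ≤ A'.card := by
    refine Finset.exists_min_image _ _ ⟨F, ?_⟩
    obtain ⟨r, hr, hmax⟩ := Finset.exists_max_image F (fun i => (R.hi i).1) hne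
    simp only [Finset.mem_filter, Finset.mem_powerset]
    exact ⟨le_rfl, hF, (R.hi r).1, ∅, le_rfl, by simp, hmax, by simp, by simp,
      fun f hf hf' => absurd hf hf'⟩
  obtain ⟨A, hA, hmin⟩ := h0
  simp only [Finset.mem_filter, Finset.mem_powerset] at hA hmin
  obtain ⟨hAF, hA2, x, C, hcut⟩ := hA
  have hAne : A.Nonempty := Finset.card_pos.1 (by have := hA2.le_card; omega)
  obtain ⟨r, hr, hmax⟩ := Finset.exists_max_image A (fun i => (R.hi i).1) hAne
  have hmid : ∀ f ∈ F, f ∉ A → f ∉ F.filter (fun i => (R.hi r).1 < (R.lo i).1) →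
      (R.lo f).1 ≤ (R.hi r).1 ∧ (R.hi r).1 ≤ (R.hi f).1 := by
    intro f hf hfA hfC
    refine ⟨by simpa [hf] using hfC, (hcut.hi_le r hr).trans ?_⟩
    by_cases h : f ∈ C
    · exact (hcut.le_lo f h).trans (R.lo_le_hi f).1
    · exact (hcut.mid f hf hfA h).2
  have hlo : ∀ c ∈ F.filter (fun i => (R.hi r).1 < (R.lo i).1), (R.hi r).1 < (R.lo c).1 :=
    fun c hc => (Finset.mem_filter.1 hc).2
  have hcut' : R.Cut F (A.erase r) (F.filter fun i => (R.hi r).1 < (R.lo i).1) (R.hi r).1 := by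
    refine ⟨(Finset.erase_subset _ _).trans hAF, Finset.filter_subset _ _,
      fun a ha => hmax a (Finset.mem_of_mem_erase ha), fun c hc => (hlo c hc).le,
      fun a ha c hc => (hmax a (Finset.mem_of_mem_erase ha)).trans_lt (hlo c hc),
      fun f hf hfA hfC => ?_⟩
    by_cases hfr : f = r
    · exact hfr ▸ ⟨(R.lo_le_hi f).1, le_rfl⟩
    · exact hmid f hf (fun h => hfA (Finset.mem_erase.2 ⟨hfr, h⟩)) hfC
  refine ⟨(R.hi r).1, A, F.filter fun i => (R.hi r).1 < (R.lo i).1, r, hr,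
    ⟨hAF, Finset.filter_subset _ _, hmax, fun c hc => (hlo c hc).le,
      fun a ha c hc => (hmax a ha).trans_lt (hlo c hc), hmid⟩, hcut', hA2, fun h2 => ?_⟩
  have := hmin _ ⟨(Finset.erase_subset _ _).trans hAF, h2, _, _, hcut'⟩
  have := Finset.card_erase_lt_of_mem hr
  omega

variable (R) in
/-- The piercing bound for `q`, for all subfamilies. -/
def PiercingBound (q : ℕ) : Prop :=
  ∀ F m n, R.HasClique q F → R.CliqueFreeBound q m F → 2 * m + 4 ≤ q * (q + 1) →
    m + 2 ≤ n + q → R.Pierced F n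

variable (R) in
/-- `A` has no `r` pairwise intersecting members, or `PiercingBound r` applies to it. -/
def Good (r : ℕ) (A : Finset ι) : Prop :=
  R.HasClique r A → ∃ M, 2 * M + 4 ≤ r * (r + 1) ∧ R.CliqueFreeBound r M A

theorem Good.pierced_pred (h : R.Good a A) (ih : R.PiercingBound a) (ha : 3 ≤ a)
    (hA : R.HasClique 2 A) (hDA : D ⊆ A) (hD : ¬ R.HasClique a D)
    (hb : R.CliqueFreeBound a D.card A) : 1 ≤ D.card ∧ R.Pierced A (D.card - 1) := by
  by_cases hc : R.HasClique a A
  · obtain ⟨M, hM, hMb⟩ := h hc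
    obtain ⟨K, hK, hKc⟩ := Finset.exists_subset_card_eq hA.le_card
    have := hb K hK (not_hasClique_of_card_lt (by omega))
    have := hMb D hDA hD
    exact ⟨by omega, ih A D.card _ hc hb (by omega) (by omega)⟩
  · have := hb A le_rfl hc
    have := hA.le_card
    exact ⟨by omega, hA.pierced (by omega)⟩

theorem Good.pierced_of_hasClique (h : R.Good a A) (ih : R.PiercingBound a)
    (hA : R.HasClique a A) (hDA : D ⊆ A) (hD : ¬ R.HasClique a D)
    (hb : R.CliqueFreeBound a D.card A) :
    a ≤ D.card + 1 ∧ R.Pierced A (D.card + 2 - a) := by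
  obtain ⟨M, hM, hMb⟩ := h hA
  have ha : a ≠ 0 := by
    rintro rfl
    omega
  obtain ⟨K, hK, hKc⟩ := Finset.exists_subset_card_eq ((Nat.sub_le a 1).trans hA.le_card)
  have := hb K hK (not_hasClique_of_card_lt (by omega))
  have := hMb D hDA hD
  exact ⟨by omega, ih A D.card _ hA hb (by omega) (by omega)⟩

theorem Cut.card_add_card_le (h : R.Cut F A C x) (hm : R.CliqueFreeBound (a + 2) m F)
    (hA : D ⊆ A) (hC : T ⊆ C) (hSB : S ⊆ F \ (A ∪ C)) (hD : ¬ R.HasClique (a + 1) D)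
    (hT : ¬ R.HasClique (a + 1) T) (hS : ¬ R.HasClique 2 S) :
    D.card + T.card + S.card ≤ m := by
  have hsep : ∀ d ∈ D, ∀ t ∈ T, (R.hi d).1 < (R.lo t).1 :=
    fun d hd t ht => h.sep d (hA hd) t (hC ht)
  have h1 := not_hasClique_union (not_hasClique_union_of_sep hsep hD hT) hS
  have h2 := hm (D ∪ T ∪ S) (by grind [h.left_subset, h.right_subset]) h1
  rwa [Finset.card_union_of_disjoint, Finset.card_union_of_disjoint (disjoint_of_sep hsep)] at h2
  exact Finset.disjoint_left.2 (by grind)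

theorem Cut.pierced_of_good (h : R.Cut F A C x) (ha : 3 ≤ a) (ih : R.PiercingBound a)
    (hA : R.HasClique 2 A) (hC : R.HasClique 2 C) (hA' : R.Good a A) (hC' : R.Good a C)
    (hF : R.HasClique (a + 1) F) (hm : R.CliqueFreeBound (a + 1) m F)
    (hn : m + 2 ≤ n + (a + 1)) : R.Pierced F n := by
  obtain ⟨b, rfl⟩ : ∃ b, a = b + 1 := ⟨a - 1, by omega⟩
  by_cases hno : ¬ R.HasClique (b + 1) A ∧ ¬ R.HasClique (b + 1) C
  · exact h.pierced_of_not_hasClique hA hC hno.1 hno.2 hF hm hn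
  obtain ⟨D, hDA, hD, hDb⟩ := exists_max_cliqueFree (R := R) (Nat.succ_ne_zero b) A
  obtain ⟨T, hTC, hT, hTb⟩ := exists_max_cliqueFree (R := R) (Nat.succ_ne_zero b) C
  obtain ⟨S, hSB, hS, hPB⟩ := h.exists_disjoint_pierced
  have hle := h.card_add_card_le hm hDA hTC hSB hD hT hS
  obtain ⟨hD1, hPA⟩ := hA'.pierced_pred ih ha hA hDA hD hDb
  obtain ⟨hT1, hPC⟩ := hC'.pierced_pred ih ha hC hTC hT hTb
  have key : ∀ u v, R.Pierced A u → R.Pierced C v → u + v + S.card ≤ n → R.Pierced F n :=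
    fun u v hu hv huv => by
      have := (hu.union hv).union hPB
      rw [Finset.union_sdiff_of_subset h.union_subset] at this
      exact this.mono huv
  by_cases hcA : R.HasClique (b + 1) A
  · obtain ⟨h1, h2⟩ := hA'.pierced_of_hasClique ih hcA hDA hD hDb
    exact key _ _ h2 hPC (by omega)
  · have hcC : R.HasClique (b + 1) C := by tauto
    obtain ⟨h1, h2⟩ := hC'.pierced_of_hasClique ih hcC hTC hT hTb
    exact key _ _ hPA h2 (by omega)

theorem Cut.pierced_of_not_good (ha : 3 ≤ a) (ih : R.PiercingBound a)
    (hF : R.HasClique (a + 1) F) (hm : R.CliqueFreeBound (a + 1) m F)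
    (hms : 2 * m + 4 ≤ (a + 1) * (a + 1 + 1)) (hn : m + 2 ≤ n + (a + 1))
    (h : R.Cut F A C x) (hA : R.HasClique 2 A) (hC : ¬ R.Good a C) : R.Pierced F n := by
  classical
  induction C using Finset.strongInduction generalizing A x with
  | H C ihC =>
    have hCc : R.HasClique a C := by
      by_contra hno
      exact hC fun h => absurd h hno
    have hCne : C.Nonempty := Finset.card_pos.1 (by have := hCc.le_card; omega)
    obtain ⟨c, hc, hmin⟩ := Finset.exists_min_image C (fun i => (R.lo i).1) hCne
    obtain ⟨A', hA'⟩ : ∃ A', A' = F.filter fun i => (R.hi i).1 < (R.lo c).1 := ⟨_, rfl⟩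
    have hmem : ∀ i, i ∈ A' ↔ i ∈ F ∧ (R.hi i).1 < (R.lo c).1 := fun i => by simp [hA']
    have hmid : ∀ f ∈ F, f ∉ A' → f ∉ C →
        (R.lo f).1 ≤ (R.lo c).1 ∧ (R.lo c).1 ≤ (R.hi f).1 := fun f hf hfA hfC => by
      refine ⟨le_trans ?_ (h.le_lo c hc), by simpa [hmem, hf] using hfA⟩
      by_cases hfA' : f ∈ A
      · exact (R.lo_le_hi f).1.trans (h.hi_le f hfA')
      · exact (h.mid f hf hfA' hfC).1
    have hcut : R.Cut F A' C (R.lo c).1 :=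
      ⟨fun i hi => ((hmem i).1 hi).1, h.right_subset, fun i hi => ((hmem i).1 hi).2.le, hmin,
        fun i hi j hj => ((hmem i).1 hi).2.trans_le (hmin j hj), hmid⟩
    have hcut' : R.Cut F A' (C.erase c) (R.lo c).1 := by
      refine ⟨hcut.left_subset, (Finset.erase_subset _ _).trans h.right_subset, hcut.hi_le,
        fun j hj => hmin j (Finset.mem_of_mem_erase hj),
        fun i hi j hj => hcut.sep i hi j (Finset.mem_of_mem_erase hj), fun f hf hfA hfC => ?_⟩
      by_cases hfc : f = c
      · exact hfc ▸ ⟨le_rfl, (R.lo_le_hi f).1⟩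
      · exact hmid f hf hfA fun hh => hfC (Finset.mem_erase.2 ⟨hfc, hh⟩)
    have hA2 : R.HasClique 2 A' := hA.mono fun i hi =>
      (hmem i).2 ⟨h.left_subset hi, h.sep i hi c hc⟩
    by_cases hgood : R.Good a (C.erase c)
    · have hC2 : R.HasClique 2 (C.erase c) := by
        obtain ⟨K, hK, hKc, hKcl⟩ := hCc
        have := Finset.pred_card_le_card_erase (s := K) (a := c)
        exact HasClique.of_le ⟨K.erase c, Finset.erase_subset_erase c hK, rfl,
          hKcl.mono (Finset.erase_subset _ _)⟩ (by omega)
      refine hcut'.pierced_of_good ha ih hA2 hC2 (fun _ => ?_) hgood hF hm hn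
      obtain ⟨b, rfl⟩ : ∃ b, a = b + 1 := ⟨a - 1, by omega⟩
      obtain ⟨D, hDA, hD, hDb⟩ := exists_max_cliqueFree (R := R) (Nat.succ_ne_zero b) A'
      obtain ⟨T, hTC, hT, hTb⟩ := exists_max_cliqueFree (R := R) (Nat.succ_ne_zero b) C
      have hle := hcut.card_add_card_le hm hDA hTC (Finset.empty_subset _) hD hT
        (not_hasClique_of_card_lt (by simp))
      refine ⟨D.card, ?_, hDb⟩
      have hTlarge : ¬ 2 * T.card + 4 ≤ (b + 1) * (b + 1 + 1) :=
        fun hsmall => hC fun _ => ⟨T.card, hsmall, hTb⟩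
      simp only [Finset.card_empty] at hle
      nlinarith
    · exact ihC _ (Finset.erase_ssubset hc) hcut' hA2 hgood

theorem piercingBound_succ (ha : 3 ≤ a) (ih : R.PiercingBound a) : R.PiercingBound (a + 1) := by
  intro F m n hF hm hms hn
  obtain ⟨x, A, C, r, hr, hcut, hcut', hA, hA'⟩ :=
    Cut.exists_first (hF.of_le (by omega : 2 ≤ a + 1))
  by_cases hC : R.HasClique 2 C
  · by_cases hgood : R.Good a C
    · refine hcut.pierced_of_good ha ih hA hC (fun h3 => ?_) hgood hF hm hn
      have := not_hasClique_union (b := 1)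
        (not_hasClique_of_card_lt (R := R) (F := {r}) (q := 2) (by simp)) hA'
      rw [← Finset.insert_eq, Finset.insert_erase hr] at this
      exact absurd (h3.of_le ha) this
    · exact Cut.pierced_of_not_good ha ih hF hm hms hn hcut hA hgood
  · exact hcut'.pierced_of_disjoint (by omega) hA' hC hF hm hn

theorem not_hasClique_pair (hij : i ≠ j) (h : ¬ (R.lo i ≤ R.hi j ∧ R.lo j ≤ R.hi i)) :
    ¬ R.HasClique 2 {i, j} := by
  rintro ⟨K, hK, hc, hcl⟩
  have := Finset.eq_of_subset_of_card_le hK (by rw [hc, Finset.card_pair hij])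
  subst this
  exact h ⟨hcl i (by simp) j (by simp), hcl j (by simp) i (by simp)⟩

theorem isClique_of_cliqueFreeBound_two (hm : R.CliqueFreeBound 2 1 F) : R.IsClique F := by
  intro i hi j hj
  by_contra hij
  have hne : i ≠ j := by
    rintro rfl
    exact hij (R.lo_le_hi i)
  have := hm {i, j} (by grind) (not_hasClique_pair hne fun h => hij h.1)
  rw [Finset.card_pair hne] at this
  omega

theorem piercingBound_two : R.PiercingBound 2 := by
  intro F m n hF hm hms hn
  refine (isClique_of_cliqueFreeBound_two fun D hD hD' => ?_).pierced.mono (?_ : 1 ≤ n)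
  · have := hm D hD hD'
    omega
  · obtain ⟨K, hK, hKc⟩ := Finset.exists_subset_card_eq ((Nat.sub_le 2 1).trans hF.le_card)
    have := hm K hK (not_hasClique_of_card_lt (by omega))
    omega

theorem pierced_three_of_cliqueFreeBound_two (hm : R.CliqueFreeBound 2 2 F) :
    R.Pierced F 3 := by
  classical
  rcases F.eq_empty_or_nonempty with rfl | hne
  · exact (pierced_card _).mono (by simp)
  obtain ⟨r, hr, hmin⟩ := Finset.exists_min_image F (fun i => (R.hi i).1) hne
  obtain ⟨C, hC⟩ : ∃ C, C = F.filter fun i => (R.hi r).1 < (R.lo i).1 := ⟨_, rfl⟩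
  have hmem : ∀ i, i ∈ C ↔ i ∈ F ∧ (R.hi r).1 < (R.lo i).1 := fun i => by simp [hC]
  have hCF : C ⊆ F := fun i hi => ((hmem i).1 hi).1
  obtain ⟨S, hSB, hS, hP⟩ := exists_disjoint_pierced (R := R) (R.hi r).1 (F \ C) fun i hi => by
    rw [Finset.mem_sdiff, hmem, not_and, not_lt] at hi
    exact ⟨hi.2 hi.1, hmin i hi.1⟩
  have hS2 := hm S (hSB.trans Finset.sdiff_subset) hS
  have hCcl : R.IsClique C := isClique_of_cliqueFreeBound_two fun D hD hD' => by
    have hsep : ∀ a ∈ ({r} : Finset ι), ∀ c ∈ D, (R.hi a).1 < (R.lo c).1 := fun a ha c hc => by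
      rw [Finset.mem_singleton.1 ha]
      exact ((hmem c).1 (hD hc)).2
    have := hm ({r} ∪ D) (by grind) (not_hasClique_union_of_sep hsep
      (not_hasClique_of_card_lt (by simp)) hD')
    rw [Finset.card_union_of_disjoint (disjoint_of_sep hsep), Finset.card_singleton] at this
    omega
  have := hP.union hCcl.pierced
  rw [Finset.sdiff_union_of_subset hCF] at this
  exact this.mono (by omega)

theorem piercingBound_three : R.PiercingBound 3 := by
  classical
  intro F m n hF hm hms hn
  obtain ⟨S, hSF, hS, hSb⟩ := exists_max_cliqueFree (R := R) two_ne_zero F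
  have hQ : 2 ≤ (F \ S).card := by
    by_contra! hlt
    have := not_hasClique_union hS
      (not_hasClique_of_card_lt (R := R) (Nat.lt_succ_self (F \ S).card))
    rw [Finset.union_sdiff_of_subset hSF] at this
    exact this (hF.of_le (by omega))
  have hbound : ∀ Y ⊆ F \ S, ¬ R.HasClique 3 (S ∪ Y) → S.card + Y.card ≤ m := fun Y hY h => by
    have := hm (S ∪ Y) (by grind) h
    rwa [Finset.card_union_of_disjoint (Finset.disjoint_sdiff.mono_right hY)] at this
  by_cases hSm : S.card + 2 ≤ m
  · by_cases hS1 : S.card ≤ 1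
    · exact (isClique_of_cliqueFreeBound_two fun D hD hD' => (hSb D hD hD').trans hS1).pierced.mono
        (by omega)
    · exact (pierced_three_of_cliqueFreeBound_two fun D hD hD' =>
        (hSb D hD hD').trans (by omega)).mono (by omega)
  have hpair : ∀ g ∈ F \ S, ∀ g' ∈ F \ S, g ≠ g' → ∃ s ∈ S, ∃ K, R.IsClique K ∧
      s ∈ K ∧ g ∈ K ∧ g' ∈ K := fun g hg g' hg' hne => by
    have hcl : R.HasClique 3 (S ∪ {g, g'}) := by
      by_contra h
      have := hbound _ (by grind) h
      rw [Finset.card_pair hne] at this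
      omega
    obtain ⟨K, hK, hKc, hKcl⟩ := hcl
    have h1 := card_inter_le_of_not_hasClique hS hKcl
    have h2 : (K ∩ {g, g'}).card ≤ ({g, g'} : Finset ι).card :=
      Finset.card_le_card Finset.inter_subset_right
    have h3 : (K ∩ S ∪ K ∩ {g, g'}).card = K.card := by
      rw [← Finset.inter_union_distrib_left, Finset.inter_eq_left.2 hK]
    have h4 := Finset.card_union_le (K ∩ S) (K ∩ {g, g'})
    have h5 := Finset.card_pair hne
    obtain ⟨s, hs⟩ := Finset.card_pos.1 (by omega : 0 < (K ∩ S).card)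
    have h6 := Finset.inter_eq_right.1 (Finset.eq_of_subset_of_card_le
      (Finset.inter_subset_right : K ∩ {g, g'} ⊆ {g, g'}) (by omega))
    exact ⟨s, (Finset.mem_inter.1 hs).2, K, hKcl, (Finset.mem_inter.1 hs).1,
      h6 (by simp), h6 (by simp)⟩
  have hP : R.Pierced F S.card := by
    refine pierced_of_cover S (fun s => insert s
      ((F \ S).filter fun i => R.lo i ≤ R.hi s ∧ R.lo s ≤ R.hi i)) ?_ ?_
    · intro s hs i hi j hj
      rw [Finset.mem_insert, Finset.mem_filter] at hi hj
      rcases hi with rfl | hi <;> rcases hj with rfl | hj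
      · exact R.lo_le_hi _
      · exact hj.2.2
      · exact hi.2.1
      · by_cases hij : i = j
        · exact hij ▸ R.lo_le_hi i
        · obtain ⟨-, -, K, hK, -, hiK, hjK⟩ := hpair i hi.1 j hj.1 hij
          exact hK i hiK j hjK
    · intro i hi
      by_cases hiS : i ∈ S
      · exact ⟨i, hiS, by simp⟩
      have hiQ : i ∈ F \ S := Finset.mem_sdiff.2 ⟨hi, hiS⟩
      obtain ⟨j, hj, hji⟩ := Finset.exists_mem_ne (by omega : 1 < (F \ S).card) i
      obtain ⟨s, hs, K, hK, hsK, hiK, -⟩ := hpair i hiQ j hj hji.symm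
      exact ⟨s, hs, by simp [hi, hiS, hK i hiK s hsK, hK s hsK i hiK]⟩
  obtain ⟨Y, hY, hYc⟩ := Finset.exists_subset_card_eq (by omega : 1 ≤ (F \ S).card)
  have := hbound Y hY fun h => not_hasClique_union hS
    (not_hasClique_of_card_lt (R := R) (Nat.lt_succ_self Y.card)) (h.of_le (by omega))
  exact hP.mono (by omega)

theorem piercingBound (hq : 2 ≤ q) : R.PiercingBound q := by
  rcases hq.eq_or_lt with rfl | hq
  · exact piercingBound_two
  · induction q, hq using Nat.le_induction with
    | base => exact piercingBound_three
    | succ q h3 ih => exact piercingBound_succ h3 (ih (by omega))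

end RectFamily

/-- Theorem 2.2 (Wegner, Dol'nikov): for axis-parallel rectangles in the plane,
`HD(p,q) = p - q + 1` whenever `p < q(q+1)/2` (i.e. `2p < q(q+1)`). -/
theorem rect_dolnikov_pq {ι : Type} [Fintype ι] (F : ι → Set (ℝ × ℝ))
    (hrect : ∀ i, IsRect (F i))
    (p q : ℕ) (hq2 : 2 ≤ q) (hqp : q ≤ p)
    (hsmall : 2 * p < q * (q + 1))
    (hpq : HasPQ F p q) :
    ∃ P : Finset (ℝ × ℝ), P.card ≤ p - q + 1 ∧ Pierces F P := by
  classical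
  choose lo hi hle hF using hrect
  let R : RectFamily ι := ⟨lo, hi, hle⟩
  have hclique : ∀ J : Finset ι, J.card = p → R.HasClique q J := fun J hJ => by
    obtain ⟨K, hKJ, hKq, x, hx⟩ := hpq.2 J hJ
    refine ⟨K, hKJ, hKq, fun i hi j hj => ?_⟩
    simp only [Set.mem_iInter, hF, Set.mem_Icc] at hx
    exact (hx i hi).1.trans (hx j hj).2
  have huniv : R.HasClique q Finset.univ := by
    obtain ⟨J, -, hJ⟩ := Finset.exists_subset_card_eq (s := (Finset.univ : Finset ι)) hpq.1
    exact (hclique J hJ).mono (Finset.subset_univ J)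
  have hbound : R.CliqueFreeBound q (p - 1) Finset.univ := fun D _ hD => by
    by_contra! h
    obtain ⟨J, hJD, hJ⟩ := Finset.exists_subset_card_eq (by omega : p ≤ D.card)
    exact hD ((hclique J hJ).mono hJD)
  have heven : Even (q * (q + 1)) := Nat.even_mul_succ_self q
  obtain ⟨k, hk⟩ := heven
  obtain ⟨P, hP, hPF⟩ := RectFamily.piercingBound hq2 Finset.univ (p - 1) (p - q + 1)
    huniv hbound (by omega) (by omega)
  exact ⟨P, hP, fun i => by
    obtain ⟨x, hx, hlo, hhi⟩ := hPF i (Finset.mem_univ i)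
    exact ⟨x, hx, by rw [hF i]; exact ⟨hlo, hhi⟩⟩⟩
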